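/- Fix i ∈ {1,…,N} and let (s_{i,ε}) be a sequence with 0 ≤ s_{i,ε} ≤ r_{i,ε}, limsup_{ε→0} γ_{i,ε}⁻¹ B_{i,ε}(s_{i,ε}) ≤ 0, and |u_ε − B_{i,ε}| ≤ D_i/γ_{i,ε} on the disk D(x_{i,ε}, s_{i,ε}) for some D_i > 0. Then liminf_{ε→0} ∫_{D(x_{i,ε}, s_{i,ε})} |∇u_ε|² dx ≥ 4π. -/

import Mathlib

open Metric Set Filter Topology Real MeasureTheory
open scoped RealInnerProductSpace

noncomputable section

/-- Points of the plane. -/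
abbrev Pt := EuclideanSpace ℝ (Fin 2)

/-- The geometer's Laplacian `Δu = -(∂²u/∂x² + ∂²u/∂y²)`. -/
def lap (u : Pt → ℝ) (x : Pt) : ℝ :=
  - ∑ i : Fin 2, fderiv ℝ (fun y => fderiv ℝ u y (EuclideanSpace.single i 1)) x
      (EuclideanSpace.single i 1)

/-- Convergence in `C^k(s)`: uniform convergence on `s` of all derivatives of order `≤ k`. -/
def TendstoCkOn (F : ℕ → Pt → ℝ) (g : Pt → ℝ) (s : Set Pt) (k : ℕ) : Prop :=
  ∀ j : ℕ, j ≤ k → TendstoUniformlyOn (fun n x => iteratedFDeriv ℝ j (F n) x)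
    (fun x => iteratedFDeriv ℝ j g x) atTop s

/-- Convergence in `C^k_loc(s)`: locally uniform convergence on `s` of all derivatives of
order `≤ k`. -/
def TendstoCkLocOn (F : ℕ → Pt → ℝ) (g : Pt → ℝ) (s : Set Pt) (k : ℕ) : Prop :=
  ∀ j : ℕ, j ≤ k → TendstoLocallyUniformlyOn (fun n x => iteratedFDeriv ℝ j (F n) x)
    (fun x => iteratedFDeriv ℝ j g x) atTop s

/-- The standard bubble profile `U(x) = -ln(1 + |x|²/4)`. -/
def Ustd (x : Pt) : ℝ := - Real.log (1 + ‖x‖ ^ 2 / 4)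

/-- The integral of a nonnegative function over a disk is bounded below through its radial
integrals between two radii. -/
theorem two_pi_mul_le_setIntegral_ball {g : Pt → ℝ} {p : Pt} {a b K : ℝ} (ha : 0 < a) (hab : a ≤ b)
    (hg : ContinuousOn g (closedBall p b)) (hg0 : ∀ x, 0 ≤ g x)
    (hK : ∀ w : Pt, ‖w‖ = 1 → K ≤ ∫ r in a..b, r * g (p + r • w)) :
    2 * π * K ≤ ∫ x in ball p b, g x := by
  set e : ℂ ≃ₗᵢ[ℝ] Pt := Complex.orthonormalBasisOneI.repr with he
  set Φ : ℂ → Pt := fun z => p + e z with hΦ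
  have hmp : MeasurePreserving Φ volume volume :=
    (measurePreserving_add_left volume p).comp
      Complex.orthonormalBasisOneI.measurePreserving_repr
  have hemb : MeasurableEmbedding Φ :=
    (measurableEmbedding_addLeft p).comp e.toHomeomorph.measurableEmbedding
  set A : Set Pt := {x | a < ‖x - p‖ ∧ ‖x - p‖ < b} with hA
  have hAo : IsOpen A :=
    IsOpen.inter (s := {x | a < ‖x - p‖}) (t := {x | ‖x - p‖ < b})
      (isOpen_lt continuous_const (by fun_prop)) (isOpen_lt (by fun_prop) continuous_const)
  have hAm : MeasurableSet A := hAo.measurableSet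
  have hAb : A ⊆ ball p b := fun x hx => by
    rw [mem_ball, dist_eq_norm]; exact hx.2
  have hint : IntegrableOn g (ball p b) :=
    (hg.integrableOn_compact (isCompact_closedBall p b)).mono_set ball_subset_closedBall
  have h1 : ∫ x in A, g x ≤ ∫ x in ball p b, g x :=
    setIntegral_mono_set hint (ae_of_all _ hg0) hAb.eventuallyLE
  refine le_trans ?_ h1
  set w : ℝ → Pt := fun θ => e ((Real.cos θ : ℂ) + (Real.sin θ : ℂ) * Complex.I) with hw
  have hwn : ∀ θ, ‖w θ‖ = 1 := fun θ => by
    rw [hw]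
    simp only [LinearIsometryEquiv.norm_map]
    rw [Complex.ofReal_cos, Complex.ofReal_sin, ← Complex.exp_mul_I, Complex.norm_exp_ofReal_mul_I]
  have hwc : Continuous w := by
    apply e.continuous.comp
    fun_prop
  have hpol : ∀ q : ℝ × ℝ, Φ (Complex.polarCoord.symm q) = p + q.1 • w q.2 := fun q => by
    rw [hΦ, Complex.polarCoord_symm_apply]
    simp only [hw]
    rw [← e.map_smul, Complex.real_smul]
  set h : ℝ × ℝ → ℝ := fun q => q.1 * g (p + q.1 • w q.2) with hh
  have h2 : ∫ x in A, g x = ∫ q in Ioo a b ×ˢ Ioo (-π) π, h q := by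
    rw [← hmp.setIntegral_preimage_emb hemb, ← integral_indicator (hemb.measurable hAm),
      ← Complex.integral_comp_polarCoord_symm, polarCoord_target]
    have hset : Ioo a b ×ˢ Ioo (-π) π = (Ioi 0 ×ˢ Ioo (-π) π) ∩ (Ioo a b ×ˢ univ) := by
      ext ⟨r, θ⟩
      simp only [mem_prod, mem_Ioo, mem_inter_iff, mem_Ioi, mem_univ, and_true]
      constructor
      · rintro ⟨⟨h1, h2⟩, h3⟩
        exact ⟨⟨ha.trans h1, h3⟩, h1, h2⟩
      · rintro ⟨⟨_, h3⟩, h1⟩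
        exact ⟨h1, h3⟩
    rw [hset, ← setIntegral_indicator (measurableSet_Ioo.prod MeasurableSet.univ)]
    refine setIntegral_congr_fun (measurableSet_Ioi.prod measurableSet_Ioo) ?_
    rintro ⟨r, θ⟩ ⟨hr, -⟩
    have hr0 : (0 : ℝ) < r := hr
    have hmem : Complex.polarCoord.symm (r, θ) ∈ Φ ⁻¹' A ↔ (r, θ) ∈ Ioo a b ×ˢ (univ : Set ℝ) := by
      rw [mem_preimage, hpol]
      simp [hA, norm_smul, hwn, abs_of_pos hr0]
    by_cases hm : (r, θ) ∈ Ioo a b ×ˢ (univ : Set ℝ)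
    · simp only [smul_eq_mul]
      rw [indicator_of_mem hm, indicator_of_mem (hmem.2 hm), hpol]
    · simp only [smul_eq_mul]
      rw [indicator_of_notMem hm, indicator_of_notMem (fun h => hm (hmem.1 h)), mul_zero]
  have hhint : IntegrableOn h (Ioo a b ×ˢ Ioo (-π) π) (volume.prod volume) := by
    have hc : ContinuousOn h (Icc a b ×ˢ Icc (-π) π) := by
      refine continuous_fst.continuousOn.mul (hg.comp (by fun_prop) ?_)
      rintro ⟨r, θ⟩ ⟨hr, -⟩
      have hr0 : (0 : ℝ) < r := ha.trans_le hr.1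
      simpa [dist_eq_norm, norm_smul, hwn, abs_of_pos hr0] using hr.2
    exact (hc.integrableOn_compact (isCompact_Icc.prod isCompact_Icc)).mono_set
      (prod_mono Ioo_subset_Icc_self Ioo_subset_Icc_self)
  rw [h2, Measure.volume_eq_prod, ← setIntegral_prod_swap,
    setIntegral_prod (fun z : ℝ × ℝ => h z.swap) hhint.swap]
  have hhint' : IntegrableOn (fun θ => ∫ r in Ioo a b, h (r, θ)) (Ioo (-π) π) := by
    have := hhint
    rw [IntegrableOn, ← Measure.prod_restrict] at this
    exact this.integral_prod_right
  have hconst : ∫ _ in Ioo (-π) π, K = 2 * π * K := by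
    rw [setIntegral_const]
    simp only [measureReal_def, Real.volume_Ioo, smul_eq_mul]
    rw [ENNReal.toReal_ofReal (by linarith [Real.pi_pos])]
    ring
  rw [← hconst]
  refine setIntegral_mono (by simp) hhint' fun θ => ?_
  have := hK (w θ) (hwn θ)
  rwa [intervalIntegral.integral_of_le hab, integral_Ioc_eq_integral_Ioo] at this

/-- A lower bound for the Dirichlet energy of a function of the plane which decreases by at least
`α - β` between two concentric circles. -/
theorem le_dirichletEnergy_ball {v : Pt → ℝ} {p : Pt} {a b α β : ℝ} {O : Set Pt} (hO : IsOpen O)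
    (hv : ContDiffOn ℝ 1 v O) (ha : 0 < a) (hab : a < b) (hbO : closedBall p b ⊆ O)
    (hβα : β ≤ α) (hα : ∀ x, ‖x - p‖ = a → α ≤ v x) (hβ : ∀ x, ‖x - p‖ = b → v x ≤ β) :
    2 * π * ((α - β) ^ 2 / Real.log (b / a)) ≤ ∫ x in ball p b, ‖gradient v x‖ ^ 2 := by
  have hgrad : ∀ x, ‖gradient v x‖ = ‖fderiv ℝ v x‖ := fun x => by
    rw [gradient, LinearIsometryEquiv.norm_map]
  have hdc : ContinuousOn (fderiv ℝ v) O := hv.continuousOn_fderiv_of_isOpen hO le_rfl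
  simp only [hgrad]
  have hL : 0 < Real.log (b / a) := Real.log_pos ((one_lt_div ha).2 hab)
  refine two_pi_mul_le_setIntegral_ball ha hab.le ((hdc.mono hbO).norm.pow 2)
    (fun x => by positivity) fun w hw => ?_
  set c := (α - β) / Real.log (b / a) with hc
  have hc0 : 0 ≤ c := div_nonneg (by linarith) hL.le
  have hmem : ∀ r ∈ Icc a b, p + r • w ∈ closedBall p b := fun r hr => by
    simpa [dist_eq_norm, norm_smul, hw, abs_of_pos (ha.trans_le hr.1)] using hr.2
  have hφc : ContinuousOn (fun r : ℝ => fderiv ℝ v (p + r • w)) (Icc a b) :=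
    hdc.comp (by fun_prop) fun r hr => hbO (hmem r hr)
  have hpos : ∀ r ∈ Icc a b, r ≠ 0 := fun r hr => (ha.trans_le hr.1).ne'
  have hder : ∀ r ∈ uIcc a b, HasDerivAt
      (fun r => -2 * c * v (p + r • w) - c ^ 2 * Real.log r)
      (-2 * c * fderiv ℝ v (p + r • w) w - c ^ 2 * r⁻¹) r := fun r hr => by
    rw [uIcc_of_le hab.le] at hr
    have h1 : HasFDerivAt v (fderiv ℝ v (p + r • w)) (p + r • w) :=
      ((hv.contDiffAt (hO.mem_nhds (hbO (hmem r hr)))).differentiableAt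
        one_ne_zero).hasFDerivAt
    have h2 : HasDerivAt (fun r : ℝ => p + r • w) w r := by
      simpa using ((hasDerivAt_id r).smul_const w).const_add p
    exact ((h1.comp_hasDerivAt r h2).const_mul _).sub
      ((Real.hasDerivAt_log (hpos r hr)).const_mul _)
  have hci : ContinuousOn (fun r => -2 * c * fderiv ℝ v (p + r • w) w - c ^ 2 * r⁻¹) (Icc a b) :=
    (continuousOn_const.mul (hφc.clm_apply continuousOn_const)).sub
      (continuousOn_const.mul (continuousOn_id.inv₀ hpos))
  have hI1 : IntervalIntegrable (fun r => -2 * c * fderiv ℝ v (p + r • w) w - c ^ 2 * r⁻¹)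
      volume a b := hci.intervalIntegrable_of_Icc hab.le
  have hI2 : IntervalIntegrable (fun r => r * ‖fderiv ℝ v (p + r • w)‖ ^ 2) volume a b :=
    (continuousOn_id.mul (hφc.norm.pow 2)).intervalIntegrable_of_Icc hab.le
  have hmono := intervalIntegral.integral_mono_on hab.le hI1 hI2 fun r hr => by
    have hr0 : 0 < r := ha.trans_le hr.1
    have hle : |fderiv ℝ v (p + r • w) w| ≤ ‖fderiv ℝ v (p + r • w)‖ := by
      simpa [hw] using (fderiv ℝ v (p + r • w)).le_opNorm w
    set y := fderiv ℝ v (p + r • w) w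
    set X := ‖fderiv ℝ v (p + r • w)‖
    have hyX : y ^ 2 ≤ X ^ 2 := sq_le_sq' (by linarith [neg_abs_le y]) ((le_abs_self y).trans hle)
    have hsq : 0 ≤ (r * y + c) ^ 2 * r⁻¹ := by positivity
    have : (r * y + c) ^ 2 * r⁻¹ = r * y ^ 2 + 2 * c * y + c ^ 2 * r⁻¹ := by
      field_simp
      ring
    nlinarith [mul_le_mul_of_nonneg_left hyX hr0.le]
  rw [intervalIntegral.integral_eq_sub_of_hasDerivAt hder hI1] at hmono
  refine le_trans ?_ hmono
  have hva : α ≤ v (p + a • w) := hα _ (by simp [norm_smul, hw, abs_of_pos ha])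
  have hvb : v (p + b • w) ≤ β := hβ _ (by simp [norm_smul, hw, abs_of_pos (ha.trans hab)])
  have hlog : Real.log (b / a) = Real.log b - Real.log a :=
    Real.log_div (ha.trans hab).ne' ha.ne'
  have hcL : c * Real.log (b / a) = α - β := div_mul_cancel₀ _ hL.ne'
  have hlhs : (α - β) ^ 2 / Real.log (b / a) = c * (α - β) := by
    rw [hc]; ring
  have hcc : c ^ 2 * (Real.log b - Real.log a) = c * (α - β) := by
    rw [← hlog, ← hcL]; ring
  rw [hlhs]
  nlinarith [mul_le_mul_of_nonneg_left hva hc0, mul_le_mul_of_nonneg_left hvb hc0]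

/-- The gradient of a function which is `C¹` up to the boundary of a bounded open set is square
integrable. -/
theorem integrableOn_norm_gradient_sq {v : Pt → ℝ} {Ω : Set Pt} (hΩ : IsOpen Ω)
    (hb : Bornology.IsBounded Ω) (hv : ContDiffOn ℝ 1 v (closure Ω)) :
    IntegrableOn (fun x => ‖gradient v x‖ ^ 2) Ω := by
  have hgrad : ∀ x, ‖gradient v x‖ = ‖fderiv ℝ v x‖ := fun x => by
    rw [gradient, LinearIsometryEquiv.norm_map]
  simp only [hgrad]
  have hbound : ∃ K, ∀ y ∈ closure Ω ∩ Ω, ‖fderiv ℝ v y‖ ≤ K := by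
    refine hb.isCompact_closure.induction_on (p := fun S => ∃ K, ∀ y ∈ S ∩ Ω, ‖fderiv ℝ v y‖ ≤ K)
      ⟨0, by simp⟩ ?_ ?_ ?_
    · rintro s t hst ⟨K, hK⟩
      exact ⟨K, fun y hy => hK y ⟨hst hy.1, hy.2⟩⟩
    · rintro s t ⟨K, hK⟩ ⟨K', hK'⟩
      refine ⟨max K K', ?_⟩
      rintro y ⟨hy | hy, hyΩ⟩
      · exact (hK y ⟨hy, hyΩ⟩).trans (le_max_left _ _)
      · exact (hK' y ⟨hy, hyΩ⟩).trans (le_max_right _ _)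
    · intro x hx
      obtain ⟨U, hU, -, -, f', hf', hf'c⟩ :=
        (contDiffWithinAt_succ_iff_hasFDerivWithinAt' (n := 0) (by simp)).1
          (by simpa using hv x hx)
      rw [insert_eq_of_mem hx] at hU
      refine ⟨U ∩ {y | ‖f' y‖ < ‖f' x‖ + 1}, inter_mem hU ?_, ‖f' x‖ + 1, ?_⟩
      · exact hf'c.continuousWithinAt.norm.eventually_lt continuousWithinAt_const (by simp)
      · rintro y ⟨⟨hyU, hy⟩, hyΩ⟩
        have h := (hf' y hyU).hasFDerivAt
          (Filter.mem_of_superset (hΩ.mem_nhds hyΩ) subset_closure)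
        rw [h.fderiv]
        exact le_of_lt hy
  obtain ⟨K, hK⟩ := hbound
  have hc : ContinuousOn (fderiv ℝ v) Ω :=
    (hv.mono subset_closure).continuousOn_fderiv_of_isOpen hΩ le_rfl
  refine Measure.integrableOn_of_bounded (M := K ^ 2) hb.measure_lt_top.ne
    (by fun_prop) ?_
  refine (ae_restrict_iff' hΩ.measurableSet).2 (ae_of_all _ fun y hy => ?_)
  rw [norm_pow, norm_norm]
  exact pow_le_pow_left₀ (norm_nonneg _) (hK y ⟨subset_closure hy, hy⟩) 2

/-- A disk whose radius does not exceed the distance from its center to the boundary of a bounded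
open set is contained in that set. -/
theorem ball_infDist_frontier_subset {Ω : Set Pt} (hb : Bornology.IsBounded Ω) {p : Pt}
    (hp : p ∈ Ω) : ball p (infDist p (frontier Ω)) ⊆ Ω := by
  have hne : Ω ≠ univ := by
    rintro rfl
    exact NormedSpace.unbounded_univ ℝ Pt hb
  obtain ⟨y, hy, hxy⟩ := exists_mem_frontier_infDist_compl_eq_dist hp hne
  refine (ball_subset_ball ?_).trans ball_infDist_compl_subset
  rw [hxy]
  exact infDist_le_dist_of_mem hy

/-- A bubble is bounded by its value at the center. -/
theorem abs_le_of_bubble_ode {B : ℝ → ℝ} {κ : ℝ} (hκ : 0 < κ) (hB : ContDiff ℝ 2 B)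
    (hB0' : deriv B 0 = 0)
    (hode : ∀ r > (0 : ℝ), deriv (deriv B) r + deriv B r / r = -(κ * B r * Real.exp (B r ^ 2)))
    {r : ℝ} (hr : 0 ≤ r) : |B r| ≤ |B 0| := by
  have hd : Differentiable ℝ B := hB.differentiable (by simp)
  have hd' : Differentiable ℝ (deriv B) :=
    ((contDiff_succ_iff_deriv (n := 1)).1 hB).2.2.differentiable (by simp)
  set E : ℝ → ℝ := fun r => deriv B r ^ 2 + κ * Real.exp (B r ^ 2) with hE
  have hder : ∀ r, HasDerivAt E (2 * deriv B r * deriv (deriv B) r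
      + κ * (Real.exp (B r ^ 2) * (2 * B r * deriv B r))) r := fun r => by
    have h1 := (hd' r).hasDerivAt.pow 2
    have h2 := ((((hd r).hasDerivAt.pow 2).exp).const_mul κ)
    exact HasDerivAt.congr_deriv (f := E) (h1.add h2) (by simp)
  have hanti : AntitoneOn E (Ici 0) := by
    refine antitoneOn_of_deriv_nonpos (convex_Ici 0)
      (fun r _ => (hder r).continuousAt.continuousWithinAt)
      (fun r _ => (hder r).differentiableAt.differentiableWithinAt) fun r hr => ?_
    rw [interior_Ici, mem_Ioi] at hr
    rw [(hder r).deriv]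
    have h1 : deriv (deriv B) r = -(κ * B r * Real.exp (B r ^ 2)) - deriv B r / r := by
      linarith [hode r hr]
    rw [h1]
    have h2 : 0 ≤ deriv B r ^ 2 / r := by positivity
    have h3 : 2 * deriv B r * (-(κ * B r * Real.exp (B r ^ 2)) - deriv B r / r)
      + κ * (Real.exp (B r ^ 2) * (2 * B r * deriv B r)) = -2 * (deriv B r ^ 2 / r) := by ring
    linarith
  have hle : E r ≤ E 0 := hanti self_mem_Ici hr hr
  simp only [hE, hB0'] at hle
  have h4 : κ * Real.exp (B r ^ 2) ≤ κ * Real.exp (B 0 ^ 2) := by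
    nlinarith [sq_nonneg (deriv B r)]
  exact sq_le_sq.1 (Real.exp_le_exp.1 (le_of_mul_le_mul_left h4 hκ))

/-- The energy of a function on a disk where it stays close to a radial profile `B` decreasing from
`γ` to less than `δ * γ`, in terms of the concentration scale `μ`. -/
theorem le_energy_of_bubble {v : Pt → ℝ} {p : Pt} {s : ℝ} {O : Set Pt} (hO : IsOpen O)
    (hv : ContDiffOn ℝ 1 v O) (hsO : ball p s ⊆ O) (hs : 0 ≤ s) {B : ℝ → ℝ} (hB : Continuous B)
    {γ μ l F M C₁ D δ : ℝ} (hB0 : B 0 = γ) (hγ1 : 1 ≤ γ) (hδ0 : 0 < δ) (hδ1 : δ < 1)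
    (hBs : B s < δ * γ) (hclose : ∀ x ∈ ball p s, |v x - B ‖x - p‖| ≤ D / γ)
    (hμ : 0 < μ) (hl : 0 < l) (hμdef : μ ^ 2 * (l * F * γ ^ 2 * Real.exp (γ ^ 2)) = 1)
    (hFM : F ≤ M) (hinner : ∀ y : Pt, ‖y‖ ≤ 1 → γ - 2 / γ ≤ v (p + μ • y))
    (hC₁ : ∀ x ∈ ball p s, l * ‖x - p‖ ^ 2 * v x ^ 2 * Real.exp (v x ^ 2) ≤ C₁)
    (hone : 1 ≤ δ * γ - D / γ) (hlt : δ * γ + D / γ < γ - 2 / γ)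
    (hint : IntegrableOn (fun x => ‖gradient v x‖ ^ 2) (ball p s)) :
    4 * π * (((1 - δ) * γ - (2 + D) / γ) ^ 2 / (γ ^ 2 + 2 * γ + Real.log (C₁ * M)))
      ≤ ∫ x in ball p s, ‖gradient v x‖ ^ 2 := by
  have hγ0 : 0 < γ := by linarith
  obtain ⟨t, ⟨ht0, hts⟩, hBt⟩ : ∃ t ∈ Icc 0 s, B t = δ * γ :=
    intermediate_value_Icc' hs hB.continuousOn ⟨hBs.le, by rw [hB0]; nlinarith⟩
  have hts : t < s := lt_of_le_of_ne hts fun h => by rw [h] at hBt; linarith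
  have ht0 : 0 < t := lt_of_le_of_ne ht0 fun h => by rw [← h, hB0] at hBt; nlinarith
  have hcirc : ∀ x, ‖x - p‖ = t → x ∈ ball p s ∧ δ * γ - D / γ ≤ v x ∧ v x ≤ δ * γ + D / γ := by
    intro x hx
    have hm : x ∈ ball p s := by rw [mem_ball, dist_eq_norm, hx]; exact hts
    have h := abs_le.1 (hclose x hm)
    rw [hx, hBt] at h
    exact ⟨hm, by linarith [h.1], by linarith [h.2]⟩
  set e₀ : Pt := EuclideanSpace.single 0 1
  have he₀ : ‖e₀‖ = 1 := by simp [e₀]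
  have hx₀ : ‖(p + t • e₀) - p‖ = t := by simp [norm_smul, he₀, abs_of_pos ht0]
  obtain ⟨hm₀, hlo, hhi⟩ := hcirc _ hx₀
  have hμt : μ < t := by
    by_contra! h
    have h1 : ‖(t / μ) • e₀‖ ≤ 1 := by
      rw [norm_smul, he₀, mul_one, Real.norm_of_nonneg (by positivity)]
      exact (div_le_one hμ).2 h
    have h2 := hinner _ h1
    rw [smul_smul, mul_div_cancel₀ _ hμ.ne'] at h2
    linarith
  have hlt2 : l * t ^ 2 ≤ C₁ := by
    have h := hC₁ _ hm₀
    rw [hx₀] at h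
    have h1 : 1 ≤ v (p + t • e₀) ^ 2 := by nlinarith
    have h2 : 1 ≤ Real.exp (v (p + t • e₀) ^ 2) := Real.one_le_exp (by positivity)
    have h3 : 0 ≤ l * t ^ 2 := by positivity
    calc l * t ^ 2 ≤ l * t ^ 2 * (v (p + t • e₀) ^ 2) := le_mul_of_one_le_right h3 h1
      _ ≤ l * t ^ 2 * (v (p + t • e₀) ^ 2) * Real.exp (v (p + t • e₀) ^ 2) :=
        le_mul_of_one_le_right (by positivity) h2
      _ ≤ C₁ := h
  have hC₁0 : 0 < C₁ := lt_of_lt_of_le (by positivity) hlt2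
  have hF0 : 0 < F := by
    by_contra! h
    have : μ ^ 2 * (l * F * γ ^ 2 * Real.exp (γ ^ 2))
      = (μ ^ 2 * l * γ ^ 2 * Real.exp (γ ^ 2)) * F := by ring
    have h2 : 0 ≤ μ ^ 2 * l * γ ^ 2 * Real.exp (γ ^ 2) := by positivity
    nlinarith [mul_nonneg h2 (neg_nonneg.2 h)]
  have hM0 : 0 < M := hF0.trans_le hFM
  have hlogpos : 0 < Real.log (t / μ) := Real.log_pos ((one_lt_div hμ).2 hμt)
  have hlog : 2 * Real.log (t / μ) ≤ γ ^ 2 + 2 * γ + Real.log (C₁ * M) := by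
    have h1 : (t / μ) ^ 2 ≤ (C₁ * M) * (γ ^ 2 * Real.exp (γ ^ 2)) := by
      have h2 : (t / μ) ^ 2 = (l * t ^ 2) * F * (γ ^ 2 * Real.exp (γ ^ 2)) := by
        rw [div_pow, div_eq_iff (by positivity)]
        linear_combination (-t ^ 2) * hμdef
      rw [h2]
      gcongr
    have h3 := Real.log_le_log (by positivity) h1
    rw [Real.log_pow, Real.log_mul (by positivity) (by positivity),
      Real.log_mul (x := γ ^ 2) (by positivity) (by positivity), Real.log_exp, Real.log_pow] at h3
    push_cast at h3
    linarith [Real.log_le_sub_one_of_pos hγ0]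
  have hen := le_dirichletEnergy_ball hO hv hμ hμt
    ((closedBall_subset_ball hts).trans hsO) hlt.le (p := p)
    (fun x hx => by
      have h := hinner (μ⁻¹ • (x - p)) (by
        rw [norm_smul, hx, Real.norm_of_nonneg (by positivity), inv_mul_cancel₀ hμ.ne'])
      rwa [smul_smul, mul_inv_cancel₀ hμ.ne', one_smul, add_sub_cancel] at h)
    (fun x hx => (hcirc x hx).2.2)
  have hmono : ∫ x in ball p t, ‖gradient v x‖ ^ 2 ≤ ∫ x in ball p s, ‖gradient v x‖ ^ 2 :=
    setIntegral_mono_set hint (ae_of_all _ fun x => by positivity)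
      (ball_subset_ball hts.le).eventuallyLE
  refine le_trans ?_ (hen.trans hmono)
  have hab : (γ - 2 / γ) - (δ * γ + D / γ) = (1 - δ) * γ - (2 + D) / γ := by ring
  rw [hab]
  set X := (1 - δ) * γ - (2 + D) / γ
  calc 4 * π * (X ^ 2 / (γ ^ 2 + 2 * γ + Real.log (C₁ * M)))
      ≤ 4 * π * (X ^ 2 / (2 * Real.log (t / μ))) := by gcongr
    _ = 2 * π * (X ^ 2 / Real.log (t / μ)) := by field_simp; ring

/-- The limit of the lower bound of `le_energy_of_bubble` as the height `γ` tends to infinity. -/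
theorem tendsto_energy_ratio {γ : ℕ → ℝ} (hγ : Tendsto γ atTop atTop) (δ K c : ℝ) :
    Tendsto (fun n => 4 * π * (((1 - δ) * γ n - K / γ n) ^ 2 / (γ n ^ 2 + 2 * γ n + c)))
      atTop (𝓝 (4 * π * (1 - δ) ^ 2)) := by
  have h1 : Tendsto (fun n => (γ n)⁻¹) atTop (𝓝 0) := hγ.inv_tendsto_atTop
  have h2 : ContinuousAt
      (fun y : ℝ => 4 * π * (((1 - δ) - K * y ^ 2) ^ 2 / (1 + 2 * y + c * y ^ 2))) 0 := by
    refine continuousAt_const.mul (ContinuousAt.div (by fun_prop) (by fun_prop) (by simp))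
  have h3 := h2.tendsto.comp h1
  simp only [ne_eq, OfNat.ofNat_ne_zero, not_false_eq_true, zero_pow, mul_zero, sub_zero,
    add_zero, div_one] at h3
  refine h3.congr' ?_
  filter_upwards [hγ.eventually_gt_atTop 0] with n hn
  have h4 : 1 + 2 * (γ n)⁻¹ + c * (γ n)⁻¹ ^ 2 = (γ n ^ 2 + 2 * γ n + c) / γ n ^ 2 := by
    field_simp
  have h5 : ((1 - δ) - K * (γ n)⁻¹ ^ 2) ^ 2 = ((1 - δ) * γ n - K / γ n) ^ 2 / γ n ^ 2 := by
    field_simp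
  simp only [Function.comp_apply]
  rw [h4, h5, div_div_div_cancel_right₀ (by positivity)]

/-- **each bump carries at least `4π` of energy.** -/
theorem stmt12
    (Ω : Set Pt) (hΩo : IsOpen Ω) (hΩb : Bornology.IsBounded Ω) (hΩne : Ω.Nonempty)
    (lam : ℕ → ℝ) (hlam : ∀ n, 0 < lam n)
    (f : ℕ → Pt → ℝ) (f₀ : Pt → ℝ)
    (hfs : ∀ n, ContDiffOn ℝ (⊤ : ℕ∞) (f n) (closure Ω))
    (hf₀s : ContDiffOn ℝ (⊤ : ℕ∞) f₀ (closure Ω))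
    (hf₀pos : ∀ x ∈ closure Ω, 0 < f₀ x)
    (hfc : TendstoCkOn f f₀ (closure Ω) 1)
    (hf2 : ∃ K : ℝ, ∀ n, ∀ x ∈ Ω, ‖iteratedFDeriv ℝ 2 (f n) x‖ ≤ K)
    (u : ℕ → Pt → ℝ)
    (hus : ∀ n, ContDiffOn ℝ (⊤ : ℕ∞) (u n) (closure Ω))
    (hup : ∀ n, ∀ x ∈ Ω, 0 < u n x)
    (hueq : ∀ n, ∀ x ∈ Ω, lap (u n) x = lam n * f n x * u n x * Real.exp ((u n x) ^ 2))
    (hubd : ∀ n, ∀ x ∈ frontier Ω, u n x = 0)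
    (C : ℝ) (hC : ∀ n, (∫ x in Ω, ‖gradient (u n) x‖ ^ 2) ≤ C)
    (N : ℕ) (hN : 1 ≤ N)
    (xc : Fin N → ℕ → Pt) (hxc : ∀ i n, xc i n ∈ Ω)
    (γ : Fin N → ℕ → ℝ) (hγdef : ∀ i n, γ i n = u n (xc i n))
    (hγ : ∀ i, Tendsto (γ i) atTop atTop)
    (hcrit : ∀ i n, gradient (u n) (xc i n) = 0)
    (μ : Fin N → ℕ → ℝ) (hμpos : ∀ i n, 0 < μ i n)
    (hμdef : ∀ i n,
      (μ i n) ^ 2 * (lam n * f n (xc i n) * (γ i n) ^ 2 * Real.exp ((γ i n) ^ 2)) = 1)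
    (hμinf : ∀ i, Tendsto (fun n => ((μ i n) ^ 2)⁻¹) atTop atTop)
    (hsep : ∀ i j, i ≠ j → Tendsto (fun n => ‖xc i n - xc j n‖ / μ i n) atTop atTop)
    (hconv : ∀ i, TendstoCkLocOn
      (fun n x => γ i n * (u n (xc i n + μ i n • x) - γ i n)) Ustd Set.univ 2)
    (C₁ : ℝ) (hC₁ : ∀ n, ∀ x ∈ Ω,
      lam n * (⨅ i, ‖xc i n - x‖) ^ 2 * (u n x) ^ 2 * Real.exp ((u n x) ^ 2) ≤ C₁)
    (C₂ : ℝ) (hC₂ : ∀ n, ∀ x ∈ Ω,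
      (⨅ i, ‖xc i n - x‖) * u n x * ‖gradient (u n) x‖ ≤ C₂)
    (rad : Fin N → ℕ → ℝ)
    (hrad : ∀ i n, rad i n = (1 / 2) * sInf (insert (Metric.infDist (xc i n) (frontier Ω))
      {d : ℝ | ∃ j, j ≠ i ∧ d = ‖xc i n - xc j n‖}))
    (Bub : Fin N → ℕ → ℝ → ℝ)
    (hBs : ∀ i n, ContDiff ℝ (⊤ : ℕ∞) (Bub i n))
    (hB0 : ∀ i n, Bub i n 0 = γ i n) (hB0' : ∀ i n, deriv (Bub i n) 0 = 0)
    (hBode : ∀ i n, ∀ r > (0 : ℝ), deriv (deriv (Bub i n)) r + deriv (Bub i n) r / r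
      = -(lam n * f n (xc i n) * Bub i n r * Real.exp ((Bub i n r) ^ 2)))
    (i : Fin N) (s : ℕ → ℝ)
    (hs0 : ∀ n, 0 ≤ s n) (hsle : ∀ n, s n ≤ rad i n)
    (hBlimsup : Filter.limsup (fun n => (γ i n)⁻¹ * Bub i n (s n)) atTop ≤ 0)
    (D : ℝ) (hD : 0 < D)
    (hclose : ∀ n, ∀ x ∈ ball (xc i n) (s n), |u n x - Bub i n ‖x - xc i n‖| ≤ D / γ i n) :
    4 * π ≤ Filter.liminf (fun n => ∫ x in ball (xc i n) (s n), ‖gradient (u n) x‖ ^ 2) atTop := by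
  have hv : ∀ n, ContDiffOn ℝ 1 (u n) (closure Ω) := fun n => (hus n).of_le (by norm_num)
  have hintΩ : ∀ n, IntegrableOn (fun x => ‖gradient (u n) x‖ ^ 2) Ω := fun n =>
    integrableOn_norm_gradient_sq hΩo hΩb (hv n)
  have hbdd : ∀ n, BddBelow (insert (infDist (xc i n) (frontier Ω))
      {d : ℝ | ∃ j, j ≠ i ∧ d = ‖xc i n - xc j n‖}) := by
    refine fun n => ⟨0, ?_⟩
    rintro d (rfl | ⟨j, -, rfl⟩)
    · exact infDist_nonneg
    · exact norm_nonneg _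
  have hs1 : ∀ n, s n ≤ infDist (xc i n) (frontier Ω) := fun n => by
    have h1 := csInf_le (hbdd n) (mem_insert _ _)
    have h2 := hsle n
    rw [hrad] at h2
    linarith [infDist_nonneg (x := xc i n) (s := frontier Ω)]
  have hs2 : ∀ n j, j ≠ i → 2 * s n ≤ ‖xc i n - xc j n‖ := fun n j hj => by
    have h1 := csInf_le (hbdd n) (mem_insert_of_mem _ ⟨j, hj, rfl⟩)
    have h2 := hsle n
    rw [hrad] at h2
    linarith
  have hsΩ : ∀ n, ball (xc i n) (s n) ⊆ Ω := fun n =>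
    (ball_subset_ball (hs1 n)).trans (ball_infDist_frontier_subset hΩb (hxc i n))
  have hupper : ∀ n, ∫ x in ball (xc i n) (s n), ‖gradient (u n) x‖ ^ 2 ≤ C := fun n =>
    (setIntegral_mono_set (hintΩ n) (ae_of_all _ fun x => by positivity)
      (hsΩ n).eventuallyLE).trans (hC n)
  have hcob : IsCoboundedUnder (· ≥ ·) atTop
      (fun n => ∫ x in ball (xc i n) (s n), ‖gradient (u n) x‖ ^ 2) :=
    (isBoundedUnder_of ⟨C, hupper⟩ : IsBoundedUnder (· ≤ ·) atTop _).isCoboundedUnder_ge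
  have hκ : ∀ n, 0 < γ i n → 0 < lam n * f n (xc i n) := fun n hn => by
    by_contra! h
    have h1 : 0 ≤ (μ i n) ^ 2 * (γ i n) ^ 2 * Real.exp ((γ i n) ^ 2) := by positivity
    nlinarith [hμdef i n, mul_nonneg h1 (neg_nonneg.2 h)]
  have hBbd : IsBoundedUnder (· ≤ ·) atTop (fun n => (γ i n)⁻¹ * Bub i n (s n)) := by
    refine isBoundedUnder_of_eventually_le (a := 1) ?_
    filter_upwards [(hγ i).eventually_gt_atTop 0] with n hn
    have h := abs_le_of_bubble_ode (hκ n hn) ((hBs i n).of_le (by norm_cast))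
      (hB0' i n) (hBode i n) (hs0 n)
    rw [hB0, abs_of_pos hn] at h
    rw [inv_mul_le_iff₀ hn, mul_one]
    exact (le_abs_self _).trans h
  obtain ⟨M, hM⟩ : ∃ M, ∀ᶠ n in atTop, f n (xc i n) ≤ M := by
    obtain ⟨M, hM⟩ := (hΩb.isCompact_closure.bddAbove_image hf₀s.continuousOn)
    refine ⟨M + 1, ?_⟩
    filter_upwards [Metric.tendstoUniformlyOn_iff.1 (hfc 0 zero_le_one) 1 one_pos] with n hn
    have hx := subset_closure (hxc i n)
    have h1 := hn _ hx
    rw [iteratedFDeriv_zero_eq_comp, iteratedFDeriv_zero_eq_comp, Function.comp_apply,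
      Function.comp_apply, LinearIsometryEquiv.dist_map, Real.dist_eq] at h1
    have h2 : f₀ (xc i n) ≤ M := hM (mem_image_of_mem _ hx)
    linarith [(abs_lt.1 h1).1]
  have hinner : ∀ᶠ n in atTop, ∀ y : Pt, ‖y‖ ≤ 1 →
      γ i n - 2 / γ i n ≤ u n (xc i n + μ i n • y) := by
    have h0 := (tendstoLocallyUniformlyOn_iff_forall_isCompact isOpen_univ).1
      (hconv i 0 (by norm_num)) (closedBall 0 1) (subset_univ _) (isCompact_closedBall _ _)
    filter_upwards [Metric.tendstoUniformlyOn_iff.1 h0 1 one_pos,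
      (hγ i).eventually_gt_atTop 0] with n hn hγ0 y hy
    have h1 := hn y (by simpa using hy)
    rw [iteratedFDeriv_zero_eq_comp, iteratedFDeriv_zero_eq_comp, Function.comp_apply,
      Function.comp_apply, LinearIsometryEquiv.dist_map, Real.dist_eq] at h1
    have h2 : -1 ≤ Ustd y := by
      have h3 := Real.log_le_sub_one_of_pos (x := 1 + ‖y‖ ^ 2 / 4) (by positivity)
      have h4 : ‖y‖ ^ 2 ≤ 1 := pow_le_one₀ (norm_nonneg _) hy
      rw [Ustd]
      linarith
    have h5 : -2 ≤ γ i n * (u n (xc i n + μ i n • y) - γ i n) := by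
      linarith [(abs_lt.1 h1).2]
    have h6 : -2 / γ i n ≤ u n (xc i n + μ i n • y) - γ i n := by
      rwa [div_le_iff₀ hγ0, mul_comm]
    have h7 : -2 / γ i n = -(2 / γ i n) := neg_div _ _
    linarith
  have hweight : ∀ n, ∀ x ∈ ball (xc i n) (s n),
      lam n * ‖x - xc i n‖ ^ 2 * (u n x) ^ 2 * Real.exp ((u n x) ^ 2) ≤ C₁ := fun n x hx => by
    have hxs : ‖x - xc i n‖ < s n := by rwa [← dist_eq_norm]
    have : Nonempty (Fin N) := ⟨i⟩
    have hinf : ‖x - xc i n‖ ≤ ⨅ j, ‖xc j n - x‖ := by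
      refine le_ciInf fun j => ?_
      by_cases hj : j = i
      · rw [hj, norm_sub_rev]
      · have h1 := norm_sub_le_norm_sub_add_norm_sub (xc i n) x (xc j n)
        rw [norm_sub_rev (xc i n) x, norm_sub_rev x (xc j n)] at h1
        linarith [hs2 n j hj]
    have hl := hlam n
    refine le_trans ?_ (hC₁ n x (hsΩ n hx))
    gcongr
  refine le_of_forall_lt fun a ha => ?_
  obtain ⟨δ, hδa, hδ0, hδ1⟩ : ∃ δ : ℝ, a < 4 * π * (1 - δ) ^ 2 ∧ 0 < δ ∧ δ < 1 := by
    have hc : Tendsto (fun δ : ℝ => 4 * π * (1 - δ) ^ 2) (𝓝[>] 0) (𝓝 (4 * π * (1 - 0) ^ 2)) :=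
      ((by fun_prop : Continuous fun δ : ℝ => 4 * π * (1 - δ) ^ 2).tendsto 0).mono_left
        nhdsWithin_le_nhds
    have h := hc.eventually_const_lt (by simpa using ha)
    exact (h.and ((eventually_mem_nhdsWithin (a := (0 : ℝ))).and
      (eventually_nhdsWithin_of_eventually_nhds (eventually_lt_nhds one_pos)))).exists
  obtain ⟨a', haa', ha'⟩ := exists_between hδa
  refine haa'.trans_le (le_liminf_of_le hcob ?_)
  filter_upwards [(tendsto_energy_ratio (hγ i) δ (2 + D) (Real.log (C₁ * M))).eventually_const_lt
      ha', hM, hinner, eventually_lt_of_limsup_lt (hBlimsup.trans_lt hδ0) hBbd,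
      (hγ i).eventually_ge_atTop 1,
      (hγ i).eventually_ge_atTop ((1 + D) / δ), (hγ i).eventually_ge_atTop ((3 + D) / (1 - δ))]
    with n hn hMn hin hBn hγ1 hγ2 hγ3
  have hγ0 : 0 < γ i n := by linarith
  have hdiv : ∀ {c : ℝ}, 0 ≤ c → c / γ i n ≤ c := fun hc => div_le_self hc hγ1
  rw [div_le_iff₀ hδ0] at hγ2
  rw [div_le_iff₀ (by linarith)] at hγ3
  rw [inv_mul_lt_iff₀ hγ0, mul_comm] at hBn
  refine hn.le.trans ?_
  exact le_energy_of_bubble hΩo ((hv n).mono subset_closure) (hsΩ n) (hs0 n)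
    (hBs i n).continuous (hB0 i n) hγ1 hδ0 hδ1 hBn (hclose n) (hμpos i n) (hlam n) (hμdef i n)
    hMn hin (hweight n) (by linarith [hdiv hD.le])
    (by linarith [hdiv hD.le, hdiv (zero_le_two (α := ℝ))]) ((hintΩ n).mono_set (hsΩ n))

end
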